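/- arXiv:cs/0610026 — 15 statements merged into one kernel-verified Lean document; each statement's English description precedes it below -/
import Mathlib

section
/- Let n0 denote the number of jobs j with p_j > OPT. Then n0 ≤ m − 1. -/
/-- The load of machine `i` under assignment `A`: total size of jobs assigned
to machine `i` divided by the speed `s i`. -/
noncomputable def mcLoad {m n : ℕ} (s : Fin m → ℝ) (p : Fin n → ℝ)
    (A : Fin n → Fin m) (i : Fin m) : ℝ :=
  (∑ j ∈ Finset.univ.filter (fun j => A j = i), p j) / s i

/-- the number of jobs of size strictly larger than `OPT`
is at most `m - 1`. -/
theorem stmt0 (m n : ℕ) (hm : 1 ≤ m) (s : Fin m → ℝ) (p : Fin n → ℝ)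
    (hs_pos : ∀ i, 0 < s i) (hs_le : ∀ i, s i ≤ 1)
    (hs_sorted : ∀ i j : Fin m, i ≤ j → s j ≤ s i)
    (hp : ∀ j, 0 < p j)
    (OPT : ℝ)
    (hOPT : IsGreatest
      (Set.range fun A : Fin n → Fin m => ⨅ i, mcLoad s p A i) OPT) :
    (Finset.univ.filter (fun j => OPT < p j)).card ≤ m - 1 := by
  by_contra hcon
  have hcard : m ≤ (Finset.univ.filter (fun j => OPT < p j)).card := by omega
  haveI : Nonempty (Fin m) := ⟨⟨0, hm⟩⟩
  obtain ⟨T, hT, hTc⟩ := Finset.exists_subset_card_eq hcard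
  let e : Fin m ≃ T := (Finset.equivFinOfCardEq hTc).symm
  let f : Fin m → Fin n := fun i => (e i : Fin n)
  have hf : Function.Injective f := fun a b h => e.injective (Subtype.ext h)
  have hlt : ∀ i, OPT < p (f i) := fun i =>
    (Finset.mem_filter.mp (hT (e i).2)).2
  let A : Fin n → Fin m := Function.invFun f
  have hA : ∀ i, A (f i) = i := Function.leftInverse_invFun hf
  have hload : ∀ i, OPT < mcLoad s p A i := by
    intro i
    have h1 : p (f i) ≤ ∑ j ∈ Finset.univ.filter (fun j => A j = i), p j :=
      Finset.single_le_sum (f := p) (fun j _ => (hp j).le)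
        (Finset.mem_filter.mpr ⟨Finset.mem_univ _, hA i⟩)
    have h2 : p (f i) ≤ mcLoad s p A i := by
      unfold mcLoad
      rw [le_div_iff₀ (hs_pos i)]
      nlinarith [hp (f i), hs_le i]
    exact (hlt i).trans_le h2
  have hle : (⨅ i, mcLoad s p A i) ≤ OPT := hOPT.2 ⟨A, rfl⟩
  obtain ⟨i, hi⟩ := exists_eq_ciInf_of_finite (f := fun i => mcLoad s p A i)
  have := hload i
  linarith
end

section
/- Let n0 denote the number of jobs j with p_j > OPT. Then the sum of the sizes of all jobs j with p_j ≤ OPT is at most 2·OPT·(m − n0 − 1) + OPT. -/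
/-- A pool of jobs of size at most `T` and total more than `T` has a part of total in `(T, 2T]`. -/
theorem exists_part {n : ℕ} (p : Fin n → ℝ) (T : ℝ) (J : Finset (Fin n)) :
    0 ≤ T → (∀ j ∈ J, p j ≤ T) → T < ∑ j ∈ J, p j →
    ∃ U ⊆ J, T < ∑ j ∈ U, p j ∧ ∑ j ∈ U, p j ≤ 2 * T := by
  classical
  induction J using Finset.induction_on with
  | empty => intro hT _ h; simp at h; linarith
  | insert a J ha ih =>
    intro hT hs h
    by_cases h1 : T < ∑ j ∈ J, p j
    · obtain ⟨U, hU, h2⟩ := ih hT (fun j hj => hs j (Finset.mem_insert_of_mem hj)) h1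
      exact ⟨U, hU.trans (Finset.subset_insert _ _), h2⟩
    · refine ⟨insert a J, Finset.Subset.refl _, h, ?_⟩
      rw [Finset.sum_insert ha]
      have := hs a (Finset.mem_insert_self _ _)
      linarith

/-- Give the part `U` to machine `a`, and use `f` for the other jobs. -/
theorem glue {m n : ℕ} (p : Fin n → ℝ) (T : ℝ) (hp : ∀ j, 0 < p j)
    (M : Finset (Fin m)) (a : Fin m) (ha : a ∉ M) (J U : Finset (Fin n)) (hUJ : U ⊆ J)
    (hU : T < ∑ j ∈ U, p j) (f : Fin n → Fin m)
    (hf : ∀ i ∈ M, T < ∑ j ∈ (J \ U).filter (fun j => f j = i), p j) :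
    ∃ g : Fin n → Fin m, ∀ i ∈ insert a M, T < ∑ j ∈ J.filter (fun j => g j = i), p j := by
  classical
  refine ⟨fun j => if j ∈ U then a else f j, fun i hi => ?_⟩
  rcases Finset.mem_insert.1 hi with rfl | hi
  · refine hU.trans_le (Finset.sum_le_sum_of_subset_of_nonneg ?_ fun j _ _ => (hp j).le)
    intro j hj
    simp [hj, hUJ hj]
  · refine (hf i hi).trans_le (Finset.sum_le_sum_of_subset_of_nonneg ?_ fun j _ _ => (hp j).le)
    intro j hj
    simp only [Finset.mem_filter, Finset.mem_sdiff] at hj ⊢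
    simp [hj]

theorem greedy {m n : ℕ} (p : Fin n → ℝ) (T : ℝ) (hT : 0 ≤ T) (hp : ∀ j, 0 < p j)
    (M : Finset (Fin m)) : ∀ J : Finset (Fin n),
    (M.card ≤ (J.filter (fun j => T < p j)).card ∨
      2 * T * ((M.card : ℝ) - (J.filter (fun j => T < p j)).card - 1) + T <
        ∑ j ∈ J.filter (fun j => p j ≤ T), p j) →
    (M.Nonempty → ∃ f : Fin n → Fin m, ∀ i ∈ M, T < ∑ j ∈ J.filter (fun j => f j = i), p j) := by
  classical
  induction M using Finset.induction_on with
  | empty => intro J _ h; simp at h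
  | insert a M ha ih =>
    intro J h _
    rw [Finset.card_insert_of_notMem ha] at h
    have key : ∃ U ⊆ J, T < ∑ j ∈ U, p j ∧ (M.card ≤ ((J \ U).filter (fun j => T < p j)).card ∨
      2 * T * ((M.card : ℝ) - ((J \ U).filter (fun j => T < p j)).card - 1) + T <
        ∑ j ∈ (J \ U).filter (fun j => p j ≤ T), p j) := by
      by_cases hB : (J.filter (fun j => T < p j)).Nonempty
      · obtain ⟨b, hb⟩ := hB
        have hb' := Finset.mem_filter.1 hb
        refine ⟨{b}, by simpa using hb'.1, by simpa using hb'.2, ?_⟩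
        have e1 : (J \ {b}).filter (fun j => T < p j) = (J.filter (fun j => T < p j)).erase b := by
          ext j; simp; tauto
        have e2 : (J \ {b}).filter (fun j => p j ≤ T) = J.filter (fun j => p j ≤ T) := by
          ext j
          simp only [Finset.mem_filter, Finset.mem_sdiff, Finset.mem_singleton]
          constructor
          · tauto
          · rintro ⟨h1, h2⟩
            refine ⟨⟨h1, ?_⟩, h2⟩
            rintro rfl
            exact absurd hb'.2 (not_lt.2 h2)
        have e3 := Finset.card_erase_add_one hb
        rw [e1, e2]
        rw [← e3] at h
        rcases h with h | h
        · left; omega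
        · right
          push_cast at h
          convert h using 3
          ring
      · rw [Finset.not_nonempty_iff_eq_empty] at hB
        have hsm : ∀ j ∈ J, p j ≤ T := fun j hj => by
          by_contra hc
          have : j ∈ J.filter (fun j => T < p j) := Finset.mem_filter.2 ⟨hj, not_le.1 hc⟩
          simp [hB] at this
        rw [hB, Finset.filter_true_of_mem hsm] at h
        have h : 2 * T * M.card + T < ∑ j ∈ J, p j := by
          rcases h with h | h
          · simp at h
          · push_cast at h
            rw [Finset.card_empty] at h
            push_cast at h
            linarith
        have h0 : 0 ≤ 2 * T * M.card := by positivity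
        obtain ⟨U, hUJ, hU1, hU2⟩ := exists_part p T J hT hsm (by linarith)
        refine ⟨U, hUJ, hU1, Or.inr ?_⟩
        have hsm' : ∀ j ∈ J \ U, p j ≤ T := fun j hj => hsm j (Finset.mem_sdiff.1 hj).1
        rw [Finset.filter_true_of_mem hsm']
        have e : (J \ U).filter (fun j => T < p j) = ∅ :=
          Finset.filter_false_of_mem fun j hj => not_lt.2 (hsm' j hj)
        rw [e, Finset.card_empty]
        have := Finset.sum_sdiff (f := p) hUJ
        push_cast
        linarith
    obtain ⟨U, hUJ, hU, hk⟩ := key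
    rcases M.eq_empty_or_nonempty with hM | hM
    · exact glue p T hp M a ha J U hUJ hU (fun _ => a) (by simp [hM])
    · obtain ⟨f, hf⟩ := ih (J \ U) hk hM
      exact glue p T hp M a ha J U hUJ hU f hf

/-- with `n0` the number of jobs of size strictly larger than `OPT`,
the total size of the jobs of size at most `OPT` is at most
`2·OPT·(m − n0 − 1) + OPT`. -/
theorem stmt1 (m n : ℕ) (hm : 1 ≤ m) (s : Fin m → ℝ) (p : Fin n → ℝ)
    (hs_pos : ∀ i, 0 < s i) (hs_le : ∀ i, s i ≤ 1)
    (hs_sorted : ∀ i j : Fin m, i ≤ j → s j ≤ s i)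
    (hp : ∀ j, 0 < p j)
    (OPT : ℝ)
    (hOPT : IsGreatest
      (Set.range fun A : Fin n → Fin m => ⨅ i, mcLoad s p A i) OPT)
    (n0 : ℕ) (hn0 : n0 = (Finset.univ.filter (fun j => OPT < p j)).card) :
    ∑ j ∈ Finset.univ.filter (fun j => p j ≤ OPT), p j
      ≤ 2 * OPT * ((m : ℝ) - n0 - 1) + OPT := by
  haveI : Nonempty (Fin m) := ⟨⟨0, hm⟩⟩
  have hT : 0 ≤ OPT := by
    obtain ⟨A, hA⟩ := hOPT.1
    rw [← hA]
    exact Real.iInf_nonneg fun i => div_nonneg (Finset.sum_nonneg fun j _ => (hp j).le) (hs_pos i).le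
  by_contra hc
  rw [not_le] at hc
  subst hn0
  obtain ⟨f, hf⟩ := greedy p OPT hT hp (Finset.univ : Finset (Fin m)) Finset.univ
    (Or.inr (by simpa using hc)) Finset.univ_nonempty
  have h1 : (⨅ i, mcLoad s p f i) ≤ OPT := hOPT.2 ⟨f, rfl⟩
  obtain ⟨i, hi⟩ := exists_eq_ciInf_of_finite (f := fun i => mcLoad s p f i)
  have h2 := hf i (Finset.mem_univ _)
  rw [← hi] at h1
  have h3 : ∑ j ∈ Finset.univ.filter (fun j => f j = i), p j ≤ mcLoad s p f i := by
    unfold mcLoad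
    rw [le_div_iff₀ (hs_pos i)]
    exact mul_le_of_le_one_right (Finset.sum_nonneg fun j _ => (hp j).le) (hs_le i)
  linarith
end

section
/- Let c > 0, let k be a natural number, and let B be a finite family of positive reals, each of size at most c, whose total sum is strictly greater than 2·c·k. Then B can be partitioned into k + 1 pairwise disjoint parts B_1, …, B_k, C such that the sum of each B_i lies in the half-open interval (c, 2c] and C is nonempty. -/
theorem exists_part_s2 {ι : Type*} [DecidableEq ι] (c : ℝ)
    (B : Finset ι) (f : ι → ℝ) (hle : ∀ b ∈ B, f b ≤ c) (hc : 0 < c)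
    (hsum : c < ∑ b ∈ B, f b) :
    ∃ S ⊆ B, c < ∑ b ∈ S, f b ∧ ∑ b ∈ S, f b ≤ 2 * c := by
  induction B using Finset.induction_on with
  | empty => simp at hsum; linarith
  | insert a s ha ih =>
    by_cases h : c < ∑ b ∈ s, f b
    · obtain ⟨S, hS, h1⟩ := ih (fun b hb => hle b (Finset.mem_insert_of_mem hb)) h
      exact ⟨S, hS.trans (Finset.subset_insert _ _), h1⟩
    · refine ⟨insert a s, subset_rfl, hsum, ?_⟩
      rw [Finset.sum_insert ha]
      have := hle a (Finset.mem_insert_self _ _)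
      linarith

/-- a finite family of positive reals, each at most `c`, with total
sum strictly greater than `2·c·k`, can be partitioned into `k` parts whose sums
lie in `(c, 2c]` together with a nonempty remainder part `C`. -/
theorem stmt2 {ι : Type*} [DecidableEq ι] (c : ℝ) (hc : 0 < c) (k : ℕ)
    (B : Finset ι) (f : ι → ℝ)
    (hpos : ∀ b ∈ B, 0 < f b) (hle : ∀ b ∈ B, f b ≤ c)
    (hsum : 2 * c * k < ∑ b ∈ B, f b) :
    ∃ (P : Fin k → Finset ι) (C : Finset ι),
      (∀ i, P i ⊆ B) ∧ C ⊆ B ∧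
      (∀ i j, i ≠ j → Disjoint (P i) (P j)) ∧
      (∀ i, Disjoint (P i) C) ∧
      (Finset.univ.biUnion P) ∪ C = B ∧
      (∀ i, c < ∑ b ∈ P i, f b ∧ ∑ b ∈ P i, f b ≤ 2 * c) ∧
      C.Nonempty := by
  induction k generalizing B with
  | zero =>
    refine ⟨fun _ => ∅, B, by simp, subset_rfl, by simp, by simp, by simp, fun i => i.elim0, ?_⟩
    rw [Finset.nonempty_iff_ne_empty]
    rintro rfl
    simp at hsum
  | succ k ih =>
    push_cast at hsum
    have hk : 0 ≤ c * k := by positivity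
    obtain ⟨S, hS, h1, h2⟩ := exists_part_s2 c B f hle hc (by linarith)
    have hd := Finset.sum_sdiff (f := f) hS
    obtain ⟨P, C, a1, a2, a3, a4, a5, a6, a7⟩ := ih (B \ S)
      (fun b hb => hpos b (Finset.sdiff_subset hb))
      (fun b hb => hle b (Finset.sdiff_subset hb)) (by linarith)
    have hSd : ∀ T ⊆ B \ S, Disjoint S T := fun T hT =>
      Finset.disjoint_of_subset_right hT Finset.disjoint_sdiff
    refine ⟨Fin.cons S P, C, ?_, a2.trans Finset.sdiff_subset, ?_, ?_, ?_, ?_, a7⟩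
    · intro i
      refine Fin.cases ?_ (fun i => ?_) i
      · simpa using hS
      · simpa using (a1 i).trans Finset.sdiff_subset
    · intro i j
      refine Fin.cases ?_ (fun i => ?_) i <;> refine Fin.cases ?_ (fun j => ?_) j
      · simp
      · intro _; simpa using hSd _ (a1 j)
      · intro _; simpa using (hSd _ (a1 i)).symm
      · intro h; simpa using a3 i j (fun e => h (by rw [e]))
    · intro i
      refine Fin.cases ?_ (fun i => ?_) i
      · simpa using hSd _ a2
      · simpa using a4 i
    · have : Finset.univ.biUnion (Fin.cons S P : Fin (k+1) → Finset ι)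
          = S ∪ Finset.univ.biUnion P := by
        ext x
        simp [Fin.exists_fin_succ]
      rw [this, Finset.union_assoc, a5, Finset.union_sdiff_of_subset hS]
    · intro i
      refine Fin.cases ?_ (fun i => ?_) i
      · simpa using ⟨h1, h2⟩
      · simpa using a6 i
end

section
/- Let 0 < ε < 1 and let Δ be a natural number with Δ ≥ 2m²/ε² + m. Assume the jobs are sorted so that p_1 ≥ p_2 ≥ ⋯ ≥ p_n and that n > Δ. Then p_{Δ+1} ≤ ε²·OPT/m. -/
/-- if the jobs are sorted in non-increasing order, `0 < ε < 1`,
`Δ ≥ 2m²/ε² + m` and `n > Δ`, then the `(Δ+1)`-st largest job has size at most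
`ε²·OPT/m`.  (Jobs are 0-indexed, so the `(Δ+1)`-st job is `p ⟨Δ, _⟩`.) -/
theorem stmt3 (m n : ℕ) (hm : 1 ≤ m) (s : Fin m → ℝ) (p : Fin n → ℝ)
    (hs_pos : ∀ i, 0 < s i) (hs_le : ∀ i, s i ≤ 1)
    (hs_sorted : ∀ i j : Fin m, i ≤ j → s j ≤ s i)
    (hp : ∀ j, 0 < p j)
    (hsorted : ∀ i j : Fin n, i ≤ j → p j ≤ p i)
    (OPT : ℝ)
    (hOPT : IsGreatest
      (Set.range fun A : Fin n → Fin m => ⨅ i, mcLoad s p A i) OPT)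
    (ε : ℝ) (hε0 : 0 < ε) (hε1 : ε < 1)
    (Δ : ℕ) (hΔ : (2 * (m : ℝ) ^ 2 / ε ^ 2 + m) ≤ Δ)
    (hn : Δ < n) :
    p ⟨Δ, hn⟩ ≤ ε ^ 2 * OPT / m := by
  set q := p ⟨Δ, hn⟩ with hq
  have hqpos : 0 < q := hp _
  have hmpos : 0 < m := hm
  have hmR : (0 : ℝ) < m := by exact_mod_cast hmpos
  haveI : Nonempty (Fin m) := ⟨⟨0, hmpos⟩⟩
  have he2 : 0 < ε ^ 2 := by positivity
  have hk : (m : ℝ) / ε ^ 2 ≤ ((Δ / m : ℕ) : ℝ) := by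
    have h1 : (Δ : ℝ) ≤ m * ((Δ / m : ℕ) : ℝ) + m := by
      have h2 := Nat.div_add_mod Δ m
      have h3 := Nat.mod_lt Δ hmpos
      have h4 : Δ ≤ m * (Δ / m) + m := by omega
      exact_mod_cast h4
    have h5 : 2 * (m : ℝ) ^ 2 / ε ^ 2 = m * (2 * (m / ε ^ 2)) := by ring
    have h6 : (m : ℝ) * (2 * (m / ε ^ 2)) ≤ m * ((Δ / m : ℕ) : ℝ) := by linarith
    have h7 := le_of_mul_le_mul_left h6 hmR
    have h8 : 0 < (m : ℝ) / ε ^ 2 := by positivity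
    linarith
  let A : Fin n → Fin m := fun j => ⟨j.1 % m, Nat.mod_lt _ hmpos⟩
  have hload : ∀ i, (m : ℝ) / ε ^ 2 * q ≤ mcLoad s p A i := by
    intro i
    have hlt : ∀ k : Fin (Δ / m), k.1 * m + i.1 < Δ := by
      intro k
      have h1 : (k.1 + 1) * m ≤ Δ / m * m := Nat.mul_le_mul_right m k.2
      have h2 := Nat.div_mul_le_self Δ m
      have h3 := i.2
      have h4 : (k.1 + 1) * m = k.1 * m + m := by ring
      omega
    let f : Fin (Δ / m) → Fin n := fun k => ⟨k.1 * m + i.1, (hlt k).trans hn⟩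
    have hf : Function.Injective f := by
      intro a b hab
      have h1 : a.1 * m + i.1 = b.1 * m + i.1 := congrArg Fin.val hab
      exact Fin.ext (Nat.eq_of_mul_eq_mul_right hmpos (Nat.add_right_cancel h1))
    have hsub : Finset.univ.image f ⊆ Finset.univ.filter (fun j => A j = i) := by
      intro j hj
      obtain ⟨k, -, rfl⟩ := Finset.mem_image.1 hj
      refine Finset.mem_filter.2 ⟨Finset.mem_univ _, Fin.ext ?_⟩
      show (k.1 * m + i.1) % m = i.1
      rw [Nat.mul_add_mod_self_right, Nat.mod_eq_of_lt i.2]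
    have hsum : ((Δ / m : ℕ) : ℝ) * q ≤ ∑ j ∈ Finset.univ.filter (fun j => A j = i), p j := by
      calc ((Δ / m : ℕ) : ℝ) * q = ∑ _k : Fin (Δ / m), q := by simp
        _ ≤ ∑ k : Fin (Δ / m), p (f k) :=
          Finset.sum_le_sum fun k _ => hsorted _ _ (Fin.le_def.2 (hlt k).le)
        _ = ∑ j ∈ Finset.univ.image f, p j := (Finset.sum_image fun a _ b _ h => hf h).symm
        _ ≤ _ := Finset.sum_le_sum_of_subset_of_nonneg hsub fun j _ _ => (hp j).le
    unfold mcLoad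
    have h0 : (m : ℝ) / ε ^ 2 * q ≤ ((Δ / m : ℕ) : ℝ) * q :=
      mul_le_mul_of_nonneg_right hk hqpos.le
    have hpos : 0 ≤ (m : ℝ) / ε ^ 2 * q := by positivity
    rw [le_div_iff₀ (hs_pos i)]
    exact (mul_le_of_le_one_right hpos (hs_le i)).trans (h0.trans hsum)
  have hO : (m : ℝ) / ε ^ 2 * q ≤ OPT := (le_ciInf hload).trans (hOPT.2 ⟨A, rfl⟩)
  rw [le_div_iff₀ hmR]
  calc q * m = ε ^ 2 * ((m : ℝ) / ε ^ 2 * q) := by field_simp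
    _ ≤ ε ^ 2 * OPT := mul_le_mul_of_nonneg_left hO he2.le
end

section
/- If Next Cover succeeds with guess G > 0 and 0 < G' ≤ G, then Next Cover also succeeds with guess G'; moreover the greedy indices can be chosen so that t_i(G') ≤ t_i(G) for every 1 ≤ i ≤ m, i.e., with guess G' each machine is covered using the same prefix of jobs as with guess G or a shorter one. -/
/-- The size of the (0-indexed) `j`-th job, extended by `0` outside the range. -/
noncomputable def jobVal (n : ℕ) (p : Fin n → ℝ) (j : ℕ) : ℝ :=
  if h : j < n then p ⟨j, h⟩ else 0

/-- `NCRun n m p G t` says that the indices `t 0 = 0 < t 1 < ⋯ < t m ≤ n`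
witness a successful run of Next Cover with guess `G` on `m` identical
machines: machine `i` (0-indexed) receives the consecutive jobs with indices in
`[t i, t (i+1))`, their total size is at least `G`, and removing the last job
of the block brings the total strictly below `G` (minimal prefix). -/
def NCRun (n m : ℕ) (p : Fin n → ℝ) (G : ℝ) (t : ℕ → ℕ) : Prop :=
  t 0 = 0 ∧ (∀ i < m, t i < t (i + 1)) ∧ t m ≤ n ∧
  ∀ i < m,
    G ≤ ∑ j ∈ Finset.Ico (t i) (t (i + 1)), jobVal n p j ∧
    ∑ j ∈ Finset.Ico (t i) (t (i + 1) - 1), jobVal n p j < G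

/-- if Next Cover succeeds with guess `G > 0` and `0 < G' ≤ G`,
then Next Cover also succeeds with guess `G'`, and the greedy indices for `G'`
can be chosen pointwise no larger than those for `G`. -/
theorem stmt4 (n m : ℕ) (hm : 1 ≤ m) (p : Fin n → ℝ)
    (hp : ∀ j, 0 < p j) (hsort : ∀ i j : Fin n, i ≤ j → p j ≤ p i)
    (G G' : ℝ) (hG : 0 < G) (hG' : 0 < G') (hle : G' ≤ G)
    (t : ℕ → ℕ) (ht : NCRun n m p G t) :
    ∃ t' : ℕ → ℕ, NCRun n m p G' t' ∧ ∀ i ≤ m, t' i ≤ t i := by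
  obtain ⟨h0, hlt, hn, hs⟩ := ht
  have hnn : ∀ j, 0 ≤ jobVal n p j := by
    intro j
    unfold jobVal
    split_ifs with h
    · exact (hp _).le
    · exact le_rfl
  let S : ℕ → Set ℕ := fun a => {k | G' ≤ ∑ j ∈ Finset.Ico a k, jobVal n p j}
  let t' : ℕ → ℕ := fun i => Nat.rec 0 (fun _ a => sInf (S a)) i
  have ht0 : t' 0 = 0 := rfl
  have hts : ∀ i, t' (i + 1) = sInf (S (t' i)) := fun _ => rfl
  have hmem : ∀ i < m, t' i ≤ t i → t (i + 1) ∈ S (t' i) := by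
    intro i hi hle'
    have h1 := (hs i hi).1
    have h2 : ∑ j ∈ Finset.Ico (t i) (t (i + 1)), jobVal n p j
        ≤ ∑ j ∈ Finset.Ico (t' i) (t (i + 1)), jobVal n p j :=
      Finset.sum_le_sum_of_subset_of_nonneg (Finset.Ico_subset_Ico_left hle')
        (fun j _ _ => hnn j)
    change G' ≤ _
    linarith
  have hb : ∀ i ≤ m, t' i ≤ t i := by
    intro i
    induction i with
    | zero => intro _; rw [ht0]; exact Nat.zero_le _
    | succ i ih =>
      intro hi
      rw [hts]
      exact Nat.sInf_le (hmem i (by omega) (ih (by omega)))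
  have hge : ∀ i < m, G' ≤ ∑ j ∈ Finset.Ico (t' i) (t' (i + 1)), jobVal n p j := by
    intro i hi
    have h := Nat.sInf_mem ⟨_, hmem i hi (hb i hi.le)⟩
    rw [hts]
    exact h
  have hinc : ∀ i < m, t' i < t' (i + 1) := by
    intro i hi
    by_contra hcon
    have h := hge i hi
    rw [Finset.Ico_eq_empty hcon, Finset.sum_empty] at h
    linarith
  refine ⟨t', ⟨ht0, hinc, (hb m le_rfl).trans hn, fun i hi => ⟨hge i hi, ?_⟩⟩, hb⟩
  have h1 := hinc i hi
  have h2 : t' (i + 1) - 1 < sInf (S (t' i)) := by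
    rw [← hts]
    omega
  exact not_le.mp (Nat.notMem_of_lt_sInf h2)
end

section
/- Suppose Next Cover succeeds with guess G > 0, producing blocks with sums S_1, …, S_m, where S_i ≥ G for all i and machine m receives all remaining jobs. Let w = min_{1 ≤ i ≤ m} S_i, and let 0 < ε ≤ G/3. If there is no way to split the sorted job sequence into m consecutive blocks each of total size at least G + ε (i.e., Next Cover fails with guess G + ε), then S_m < m·w + ε. -/
/-- The total size of the block of consecutive jobs with indices in
`[t i, t (i+1))`. -/
noncomputable def blockSum (n : ℕ) (p : Fin n → ℝ) (t : ℕ → ℕ) (i : ℕ) : ℝ :=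
  ∑ j ∈ Finset.Ico (t i) (t (i + 1)), jobVal n p j

theorem step_aux (f : ℕ → ℝ) (hf0 : ∀ j, 0 ≤ f j) (hf : Antitone f) (G w H : ℝ) (hG : 0 < G)
    (hGw : G ≤ w) (hH0 : G < H) (hH : H ≤ 4 * G / 3) (a n : ℕ)
    (hrem : H ≤ ∑ j ∈ Finset.range n, f j - ∑ j ∈ Finset.range a, f j) :
    ∃ b, a ≤ b ∧ b ≤ n ∧ H ≤ ∑ j ∈ Finset.range b, f j - ∑ j ∈ Finset.range a, f j ∧
      ∑ j ∈ Finset.range b, f j - ∑ j ∈ Finset.range a, f j ≤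
        2 * w + (∑ j ∈ Finset.range b, max (f j - w) 0 - ∑ j ∈ Finset.range a, max (f j - w) 0) := by
  classical
  have hP : Monotone (fun k => ∑ j ∈ Finset.range k, f j) :=
    monotone_nat_of_le_succ fun k => by
      simp only [Finset.sum_range_succ]; linarith [hf0 k]
  have hE : Monotone (fun k => ∑ j ∈ Finset.range k, max (f j - w) 0) :=
    monotone_nat_of_le_succ fun k => by
      simp only [Finset.sum_range_succ]; linarith [le_max_right (f k - w) 0]
  have hex : ∃ b, H ≤ ∑ j ∈ Finset.range b, f j - ∑ j ∈ Finset.range a, f j := ⟨n, hrem⟩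
  obtain ⟨b, hb, hbn, hbmin⟩ : ∃ b, (H ≤ ∑ j ∈ Finset.range b, f j - ∑ j ∈ Finset.range a, f j) ∧
      b ≤ n ∧ ∀ c < b, ∑ j ∈ Finset.range c, f j - ∑ j ∈ Finset.range a, f j < H :=
    ⟨Nat.find hex, Nat.find_spec hex, Nat.find_min' hex hrem,
      fun c hc => not_le.mp (Nat.find_min hex hc)⟩
  have hab : a < b := by
    by_contra hcon
    have := hP (not_lt.mp hcon)
    simp only at this
    linarith
  refine ⟨b, hab.le, hbn, hb, ?_⟩
  obtain ⟨c, rfl⟩ : ∃ c, b = c + 1 := ⟨b - 1, by omega⟩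
  have hc := hbmin c (by omega)
  have hEab := hE hab.le
  simp only at hEab
  rcases Nat.lt_or_ge c (a + 1) with h | h
  · obtain rfl : c = a := by omega
    simp only [Finset.sum_range_succ]
    linarith [le_max_left (f c - w) 0]
  rcases Nat.lt_or_ge c (a + 2) with h' | h'
  · obtain rfl : c = a + 1 := by omega
    simp only [Finset.sum_range_succ]
    linarith [le_max_left (f a - w) 0, le_max_left (f (a + 1) - w) 0]
  · have h2 := hP h'
    simp only [Finset.sum_range_succ] at h2
    have h3 : f c ≤ f (a + 1) := hf (by omega)
    have h4 : f (a + 1) ≤ f a := hf (by omega)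
    rw [Finset.sum_range_succ f c]
    linarith

/-- suppose Next Cover succeeds with guess `G > 0` on `m ≥ 2`
identical machines, producing consecutive blocks with sums `S 0, …, S (m-1)`
(machines 0-indexed; machines `0, …, m-2` get minimal prefixes of total size at
least `G`, machine `m-1` gets all remaining jobs, of total size at least `G`).
Let `w` be the minimum block sum, and let `0 < ε ≤ G/3`. If the sorted job
sequence cannot be split into `m` consecutive blocks each of total size at
least `G + ε`, then `S (m-1) < m·w + ε`. -/
theorem stmt5 (n m : ℕ) (hm : 2 ≤ m) (p : Fin n → ℝ)
    (hp : ∀ j, 0 < p j) (hsort : ∀ i j : Fin n, i ≤ j → p j ≤ p i)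
    (G : ℝ) (hG : 0 < G)
    (t : ℕ → ℕ) (ht0 : t 0 = 0) (htm : t m = n)
    (htmono : ∀ i < m, t i < t (i + 1))
    (hcov : ∀ i < m, G ≤ blockSum n p t i)
    (hmin : ∀ i < m - 1,
      ∑ j ∈ Finset.Ico (t i) (t (i + 1) - 1), jobVal n p j < G)
    (w : ℝ) (hw_le : ∀ i < m, w ≤ blockSum n p t i)
    (hw_mem : ∃ i < m, blockSum n p t i = w)
    (ε : ℝ) (hε0 : 0 < ε) (hε : ε ≤ G / 3)
    (hfail : ¬ ∃ u : ℕ → ℕ, u 0 = 0 ∧ u m = n ∧ (∀ i < m, u i ≤ u (i + 1)) ∧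
      ∀ i < m, G + ε ≤ blockSum n p u i) :
    blockSum n p t (m - 1) < m * w + ε := by
  classical
  set f := jobVal n p with hfdef
  have hf0 : ∀ j, 0 ≤ f j := fun j => by
    simp only [hfdef, jobVal]; split_ifs with h
    · exact (hp _).le
    · exact le_rfl
  have hf : Antitone f := fun i j hij => by
    simp only [hfdef, jobVal]
    by_cases hj : j < n
    · have hi : i < n := by omega
      simp only [hi, hj, dif_pos]
      exact hsort _ _ hij
    · simp only [hj, dif_neg, not_false_eq_true]
      exact hf0 i
  have hbs : ∀ u : ℕ → ℕ, ∀ i, u i ≤ u (i + 1) → blockSum n p u i =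
      ∑ j ∈ Finset.range (u (i + 1)), f j - ∑ j ∈ Finset.range (u i), f j := fun u i hi =>
    Finset.sum_Ico_eq_sub _ hi
  obtain ⟨k, hkm, hk⟩ := hw_mem
  have hGw : G ≤ w := hk ▸ hcov k hkm
  have hmR : (2 : ℝ) ≤ m := by exact_mod_cast hm
  by_contra hcon
  have hcon := not_lt.mp hcon
  have hkm1 : k < m - 1 := by
    by_contra h
    obtain rfl : k = m - 1 := by omega
    nlinarith
  have htle : ∀ j ≤ m, ∀ i ≤ j, t i ≤ t j := by
    intro j
    induction j with
    | zero => intro _ i hi; obtain rfl : i = 0 := by omega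
              exact le_rfl
    | succ j ih =>
      intro hj i hi
      rcases Nat.lt_or_ge i (j + 1) with h | h
      · exact (ih (by omega) i (by omega)).trans (htmono j (by omega)).le
      · obtain rfl : i = j + 1 := by omega
        exact le_rfl
  -- lower bound on the prefix sums of t
  have hlow : ∀ i ≤ m - 1, i * w + ∑ j ∈ Finset.range (t i), max (f j - w) 0 ≤
      ∑ j ∈ Finset.range (t i), f j := by
    intro i
    induction i with
    | zero => intro _; simp [ht0]
    | succ i ih =>
      intro hi
      have h1 := ih (by omega)
      have hlt := htmono i (by omega)
      have h2 := hw_le i (by omega)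
      rw [hbs t i hlt.le] at h2
      push_cast
      rcases Nat.lt_or_ge (t i + 1) (t (i + 1)) with h | h
      · have h3 := hmin i (by omega)
        have h4 : f (t i) ≤ ∑ j ∈ Finset.Ico (t i) (t (i + 1) - 1), f j :=
          Finset.single_le_sum (f := f) (fun j _ => hf0 j) (by simp; omega)
        have h5 : ∑ j ∈ Finset.Ico (t i) (t (i + 1)), max (f j - w) 0 = 0 := by
          apply Finset.sum_eq_zero
          intro j hj
          have := hf (Finset.mem_Ico.mp hj).1
          exact max_eq_right (by linarith)
        rw [Finset.sum_Ico_eq_sub _ hlt.le] at h5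
        linarith
      · have he : t (i + 1) = t i + 1 := by omega
        rw [he] at h2 ⊢
        simp only [Finset.sum_range_succ] at h2 ⊢
        have : max (f (t i) - w) 0 = f (t i) - w := max_eq_left (by linarith)
        rw [this]
        linarith
  have htn : t (m - 1) ≤ n := htm ▸ htle m le_rfl (m - 1) (by omega)
  have hlast : ∑ j ∈ Finset.range n, max (f j - w) 0 ≤
      ∑ j ∈ Finset.range (t (m - 1)), max (f j - w) 0 := by
    have h5 : ∑ j ∈ Finset.Ico (t (m - 1)) n, max (f j - w) 0 = 0 := by
      apply Finset.sum_eq_zero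
      intro j hj
      have h1 : t k ≤ j := (htle (m - 1) (by omega) k (by omega)).trans (Finset.mem_Ico.mp hj).1
      have h2 := hf h1
      have h3 : f (t k) ≤ ∑ j ∈ Finset.Ico (t k) (t (k + 1)), f j :=
        Finset.single_le_sum (f := f) (fun j _ => hf0 j)
          (by simpa using htmono k hkm)
      have h4 : ∑ j ∈ Finset.Ico (t k) (t (k + 1)), f j = w := hk
      exact max_eq_right (by linarith)
    rw [Finset.sum_Ico_eq_sub _ htn] at h5
    linarith
  have hm1 : m - 1 + 1 = m := by omega
  have hmc : ((m - 1 : ℕ) : ℝ) = m - 1 := by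
    rw [Nat.cast_sub (by omega)]; simp
  have htot : 2 * ((m : ℝ) - 1) * w + (G + ε) + ∑ j ∈ Finset.range n, max (f j - w) 0 ≤
      ∑ j ∈ Finset.range n, f j := by
    rw [hbs t (m - 1) (by rw [hm1, htm]; exact htn), hm1, htm] at hcon
    have := hlow (m - 1) le_rfl
    rw [hmc] at this
    linarith
  have hE : Monotone (fun k => ∑ j ∈ Finset.range k, max (f j - w) 0) :=
    monotone_nat_of_le_succ fun k => by
      simp only [Finset.sum_range_succ]; linarith [le_max_right (f k - w) 0]
  have hstep : ∀ a : ℕ, ∃ b, ∀ i ≤ m - 1, a ≤ n → ∑ j ∈ Finset.range a, f j ≤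
      2 * i * w + ∑ j ∈ Finset.range a, max (f j - w) 0 → a ≤ b ∧ b ≤ n ∧
      G + ε ≤ ∑ j ∈ Finset.range b, f j - ∑ j ∈ Finset.range a, f j ∧
      ∑ j ∈ Finset.range b, f j ≤
      2 * (i + 1 : ℕ) * w + ∑ j ∈ Finset.range b, max (f j - w) 0 := by
    intro a
    by_cases hr : G + ε ≤ ∑ j ∈ Finset.range n, f j - ∑ j ∈ Finset.range a, f j
    · obtain ⟨b, h1, h2, h3, h4⟩ := step_aux f hf0 hf G w (G + ε) hG hGw (by linarith)
        (by linarith) a n hr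
      refine ⟨b, fun i hi ha h => ⟨h1, h2, h3, ?_⟩⟩
      push_cast
      linarith
    · refine ⟨a, fun i hi ha h => absurd ?_ hr⟩
      have h1 := hE ha
      simp only at h1
      have h2 : (i : ℝ) ≤ m - 1 := by rw [← hmc]; exact_mod_cast hi
      have h3 : (i : ℝ) * w ≤ (m - 1) * w := mul_le_mul_of_nonneg_right h2 (by linarith)
      linarith
  choose g hg using hstep
  have hinv : ∀ i ≤ m - 1, g^[i] 0 ≤ n ∧ ∑ j ∈ Finset.range (g^[i] 0), f j ≤
      2 * i * w + ∑ j ∈ Finset.range (g^[i] 0), max (f j - w) 0 := by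
    intro i
    induction i with
    | zero => intro _; simp
    | succ i ih =>
      intro hi
      obtain ⟨h1, h2⟩ := ih (by omega)
      have := hg _ i (by omega) h1 h2
      rw [Function.iterate_succ_apply']
      exact ⟨this.2.1, this.2.2.2⟩
  apply hfail
  let u : ℕ → ℕ := fun i => if i < m then g^[i] 0 else n
  have hu : ∀ i < m, u i ≤ u (i + 1) ∧
      G + ε ≤ ∑ j ∈ Finset.range (u (i + 1)), f j - ∑ j ∈ Finset.range (u i), f j := by
    intro i hi
    obtain ⟨h1, h2⟩ := hinv i (by omega)
    have hui : u i = g^[i] 0 := if_pos hi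
    by_cases hi' : i + 1 < m
    · have hui' : u (i + 1) = g (g^[i] 0) := by
        rw [← Function.iterate_succ_apply' g]; exact if_pos hi'
      rw [hui, hui']
      have := hg _ i (by omega) h1 h2
      exact ⟨this.1, this.2.2.1⟩
    · have hui' : u (i + 1) = n := if_neg hi'
      rw [hui, hui']
      refine ⟨h1, ?_⟩
      obtain rfl : i = m - 1 := by omega
      rw [hmc] at h2
      have h3 := hE h1
      simp only at h3
      linarith
  refine ⟨u, ?_, ?_, fun i hi => (hu i hi).1, fun i hi => ?_⟩
  · have : u 0 = g^[0] 0 := if_pos (by omega)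
    simpa using this
  · exact if_neg (lt_irrefl m)
  · rw [hbs u i (hu i hi).1]
    exact (hu i hi).2
end

section
/- Suppose the jobs, of total size 1, are partitioned into m sets with sums W_1 ≥ W_2 ≥ ⋯ ≥ W_m, and the set with sum W_j is assigned to machine j. If W_j ≥ 1/(j·m) for every 1 ≤ j ≤ m, then W_j/s_j ≥ OPT/m for every j; that is, this assignment covers every machine to at least OPT/m. -/
/-- if the jobs (of total size `1`) are partitioned into `m` sets
with sums `W 0 ≥ W 1 ≥ ⋯ ≥ W (m-1)`, the set of sum `W j` going to machine `j`,
and `W j ≥ 1/(j·m)` (with `j` interpreted 1-indexed) for every machine, then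
every machine is covered to at least `OPT/m`. -/
theorem stmt6 (m n : ℕ) (hm : 1 ≤ m) (s : Fin m → ℝ) (p : Fin n → ℝ)
    (hs_pos : ∀ i, 0 < s i)
    (hs_sorted : ∀ i j : Fin m, i ≤ j → s j ≤ s i)
    (hp : ∀ j, 0 < p j) (htot : ∑ j, p j = 1)
    (OPT : ℝ)
    (hOPT : IsGreatest
      (Set.range fun A : Fin n → Fin m => ⨅ i, mcLoad s p A i) OPT)
    (W : Fin m → ℝ) (hW_sorted : ∀ i j : Fin m, i ≤ j → W j ≤ W i)
    (A : Fin n → Fin m)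
    (hA : ∀ i : Fin m, ∑ j ∈ Finset.univ.filter (fun j => A j = i), p j = W i)
    (hWlb : ∀ i : Fin m, 1 / ((((i : ℕ) : ℝ) + 1) * m) ≤ W i) :
    ∀ i : Fin m, OPT / m ≤ W i / s i := by
  intro i
  have hm0 : (0 : ℝ) < m := by exact_mod_cast hm
  obtain ⟨⟨B, hB⟩, -⟩ := hOPT
  have hB' : (⨅ k, mcLoad s p B k) = OPT := hB
  have hnn : 0 ≤ OPT := by
    rw [← hB']
    exact Real.iInf_nonneg fun k =>
      div_nonneg (Finset.sum_nonneg fun j _ => (hp j).le) (hs_pos k).le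
  have hle : ∀ k, OPT * s k ≤ ∑ j ∈ Finset.univ.filter (fun j => B j = k), p j := by
    intro k
    have h : OPT ≤ mcLoad s p B k := by
      rw [← hB']
      exact ciInf_le (Set.finite_range _).bddBelow k
    exact (le_div_iff₀ (hs_pos k)).1 h
  have hsum : ∑ k, ∑ j ∈ Finset.univ.filter (fun j => B j = k), p j = 1 := by
    rw [← htot]
    exact Finset.sum_fiberwise _ _ _
  have hkey : (((i : ℕ) : ℝ) + 1) * (OPT * s i) ≤ 1 := by
    calc (((i : ℕ) : ℝ) + 1) * (OPT * s i)
        = ∑ k ∈ Finset.Iic i, OPT * s i := by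
          rw [Finset.sum_const, Fin.card_Iic, nsmul_eq_mul]; push_cast; ring
      _ ≤ ∑ k ∈ Finset.Iic i, OPT * s k :=
          Finset.sum_le_sum fun k hk =>
            mul_le_mul_of_nonneg_left (hs_sorted k i (Finset.mem_Iic.1 hk)) hnn
      _ ≤ ∑ k, OPT * s k :=
          Finset.sum_le_sum_of_subset_of_nonneg (Finset.subset_univ _)
            fun k _ _ => mul_nonneg hnn (hs_pos k).le
      _ ≤ 1 := by
          rw [← hsum]
          exact Finset.sum_le_sum fun k _ => hle k
  have hi : (0 : ℝ) < ((i : ℕ) : ℝ) + 1 := by positivity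
  rw [le_div_iff₀ (hs_pos i)]
  refine le_trans ?_ (hWlb i)
  rw [le_div_iff₀ (mul_pos hi hm0)]
  calc OPT / m * s i * ((((i : ℕ) : ℝ) + 1) * m)
      = (((i : ℕ) : ℝ) + 1) * (OPT * s i) := by field_simp
    _ ≤ 1 := hkey
end

section
/- Under the Round Robin assignment, the load of every machine is at least OPT/m; in particular, Round Robin is an m-approximation algorithm for the machine covering problem. -/
/-- under the Round Robin assignment (job `j`, 0-indexed in the
sorted order, goes to machine `j mod m`, 0-indexed), the load of every machine
is at least `OPT/m`; hence Round Robin is an `m`-approximation for machine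
covering. -/
theorem stmt7 (m n : ℕ) (hm : 1 ≤ m) (s : Fin m → ℝ) (p : Fin n → ℝ)
    (hs_pos : ∀ i, 0 < s i)
    (hs_sorted : ∀ i j : Fin m, i ≤ j → s j ≤ s i)
    (hp : ∀ j, 0 < p j) (hpsorted : ∀ i j : Fin n, i ≤ j → p j ≤ p i)
    (OPT : ℝ)
    (hOPT : IsGreatest
      (Set.range fun A : Fin n → Fin m => ⨅ i, mcLoad s p A i) OPT)
    (RR : Fin n → Fin m) (hRR : ∀ j : Fin n, (RR j : ℕ) = (j : ℕ) % m) :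
    ∀ i : Fin m, OPT / m ≤ mcLoad s p RR i := by
  intro i
  obtain ⟨⟨A, hA⟩, -⟩ := hOPT
  simp only at hA
  have hmpos : (0:ℝ) < m := by exact_mod_cast hm
  -- pigeonhole: some machine k ≤ i gets none of the first i jobs
  obtain ⟨k, hki, hk⟩ : ∃ k : Fin m, k ≤ i ∧ ∀ j : Fin n, A j = k → (i : ℕ) ≤ j := by
    by_contra hcon
    push Not at hcon
    have hsub : Finset.Iic i ⊆
        (Finset.univ.filter (fun j : Fin n => (j : ℕ) < i)).image A := by
      intro k hk
      obtain ⟨j, hj, hlt⟩ := hcon k (Finset.mem_Iic.mp hk)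
      exact Finset.mem_image.mpr ⟨j, by simpa using hlt, hj⟩
    have h1 := Finset.card_le_card hsub
    have h2 : ((Finset.univ.filter (fun j : Fin n => (j : ℕ) < i)).image A).card ≤ _ :=
      Finset.card_image_le
    have h3 : (Finset.univ.filter (fun j : Fin n => (j : ℕ) < i)).card
        ≤ (Finset.range (i : ℕ)).card := by
      apply Finset.card_le_card_of_injOn (fun j : Fin n => (j : ℕ))
      · intro j hj
        simpa using hj
      · intro a _ b _ hab
        exact Fin.ext hab
    rw [Fin.card_Iic] at h1
    rw [Finset.card_range] at h3
    omega
  -- sum of jobs from i on is at most m times the Round Robin sum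
  have hsum : ∑ j ∈ Finset.univ.filter (fun j : Fin n => (i : ℕ) ≤ j), p j
      ≤ m * ∑ j ∈ Finset.univ.filter (fun j => RR j = i), p j := by
    let g : Fin n → Fin n := fun j =>
      if h : (i : ℕ) ≤ j then
        ⟨i + m * (((j : ℕ) - i) / m), by
          have := Nat.mul_div_le ((j : ℕ) - i) m
          have := j.isLt
          omega⟩
      else j
    have hg : ∀ j : Fin n, (i : ℕ) ≤ j → (g j : ℕ) = i + m * (((j : ℕ) - i) / m) := by
      intro j h
      simp [g, h]
    have hmaps : ∀ j ∈ Finset.univ.filter (fun j : Fin n => (i : ℕ) ≤ j),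
        g j ∈ Finset.univ.filter (fun j => RR j = i) := by
      intro j hj
      have hj : (i : ℕ) ≤ j := by simpa using hj
      rw [Finset.mem_filter]
      refine ⟨Finset.mem_univ _, Fin.ext ?_⟩
      rw [hRR, hg j hj, Nat.add_mul_mod_self_left, Nat.mod_eq_of_lt i.isLt]
    have hrange : ∀ j : Fin n, (i : ℕ) ≤ j → (g j : ℕ) ≤ j ∧ (j : ℕ) < g j + m := by
      intro j hj
      rw [hg j hj]
      have h1 := Nat.div_add_mod ((j : ℕ) - i) m
      have h2 := Nat.mod_lt ((j : ℕ) - i) hm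
      omega
    rw [← Finset.sum_fiberwise_of_maps_to hmaps, Finset.mul_sum]
    apply Finset.sum_le_sum
    intro v _
    have hcard : ((Finset.univ.filter (fun j : Fin n => (i : ℕ) ≤ j)).filter
        (fun j => g j = v)).card ≤ (Finset.Ico (v : ℕ) (v + m)).card := by
      apply Finset.card_le_card_of_injOn (fun j : Fin n => (j : ℕ))
      · intro j hj
        have hj : (i : ℕ) ≤ j ∧ g j = v := by simpa using hj
        have := hrange j hj.1
        rw [hj.2] at this
        simpa using this
      · intro a _ b _ hab
        exact Fin.ext hab
    rw [Nat.card_Ico, Nat.add_sub_cancel_left] at hcard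
    refine (Finset.sum_le_card_nsmul _ _ (p v) ?_).trans ?_
    · intro j hj
      have hj : (i : ℕ) ≤ j ∧ g j = v := by simpa using hj
      have := hrange j hj.1
      rw [hj.2] at this
      exact hpsorted v j this.1
    · rw [nsmul_eq_mul]
      exact mul_le_mul_of_nonneg_right (by exact_mod_cast hcard) (hp v).le
  have hOk : OPT ≤ mcLoad s p A k := by
    rw [← hA]
    exact ciInf_le (Set.finite_range _).bddBelow k
  have hsumk : ∑ j ∈ Finset.univ.filter (fun j => A j = k), p j
      ≤ ∑ j ∈ Finset.univ.filter (fun j : Fin n => (i : ℕ) ≤ j), p j := by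
    apply Finset.sum_le_sum_of_subset_of_nonneg
    · intro j hj
      simpa using hk j (by simpa using hj)
    · intro j _ _
      exact (hp j).le
  rw [div_le_iff₀ hmpos]
  refine hOk.trans ?_
  unfold mcLoad
  have hnn : 0 ≤ ∑ j ∈ Finset.univ.filter (fun j => A j = k), p j :=
    Finset.sum_nonneg fun j _ => (hp j).le
  calc _ ≤ (∑ j ∈ Finset.univ.filter (fun j => A j = k), p j) / s i :=
        div_le_div_of_nonneg_left hnn (hs_pos i) (hs_sorted k i hki)
    _ ≤ (m * ∑ j ∈ Finset.univ.filter (fun j => RR j = i), p j) / s i :=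
        div_le_div_of_nonneg_right (hsumk.trans hsum) (hs_pos i).le
    _ = _ := by ring
end

section
/- Let m ≥ 2, let all m machine speeds equal 1, and let the sorted job list consist of m − 1 jobs of size 1 followed by m jobs of size 1/m. Then Round Robin assigns to machine m a single job of size 1/m, so its cover (minimum load) equals 1/m, while the assignment that places one size-1 job on each of the machines 1, …, m−1 and all m jobs of size 1/m on machine m achieves a cover of 1. Hence the approximation ratio of Round Robin is not better than m. -/
/-- on `m ≥ 2` identical machines of speed `1`, with `m-1` jobs of
size `1` followed by `m` jobs of size `1/m` (sorted), Round Robin gives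
machine `m` (0-indexed: machine `m-1`) a single job of size `1/m`, so its
cover (minimum load) is `1/m`, whereas the assignment placing one size-1 job
on each of the first `m-1` machines and all size-`1/m` jobs on the last
machine achieves a cover of `1`. Hence the approximation ratio of Round Robin
is not better than `m`. -/
theorem stmt8 (m : ℕ) (hm : 2 ≤ m) (s : Fin m → ℝ) (hs : ∀ i, s i = 1)
    (p : Fin (2 * m - 1) → ℝ)
    (hp : ∀ j, p j = if (j : ℕ) < m - 1 then 1 else (1 : ℝ) / m)
    (RR : Fin (2 * m - 1) → Fin m) (hRR : ∀ j, (RR j : ℕ) = (j : ℕ) % m)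
    (B : Fin (2 * m - 1) → Fin m)
    (hB : ∀ j, (B j : ℕ) = if (j : ℕ) < m - 1 then (j : ℕ) else m - 1) :
    (Finset.univ.filter (fun j => RR j = ⟨m - 1, by omega⟩)).card = 1 ∧
    (∑ j ∈ Finset.univ.filter (fun j => RR j = ⟨m - 1, by omega⟩), p j)
      = 1 / m ∧
    IsLeast (Set.range fun i : Fin m => mcLoad s p RR i) (1 / m) ∧
    IsLeast (Set.range fun i : Fin m => mcLoad s p B i) 1 := by
  have hm0 : (0 : ℝ) < m := by exact_mod_cast (by omega : 0 < m)
  have hinv : (1 : ℝ) / m ≤ 1 := by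
    rw [div_le_one hm0]
    exact_mod_cast (by omega : 1 ≤ m)
  have hp1 : ∀ j, (1 : ℝ) / m ≤ p j := by
    intro j
    rw [hp]
    split_ifs
    · exact hinv
    · exact le_rfl
  have hp0 : ∀ j, 0 ≤ p j := fun j => le_trans (by positivity) (hp1 j)
  have hR : Finset.univ.filter (fun j => RR j = ⟨m - 1, by omega⟩)
      = {(⟨m - 1, by omega⟩ : Fin (2 * m - 1))} := by
    ext j
    have hj := j.isLt
    simp only [Finset.mem_filter, Finset.mem_univ, true_and, Finset.mem_singleton, Fin.ext_iff, hRR]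
    by_cases h : (j : ℕ) < m
    · rw [Nat.mod_eq_of_lt h]
    · rw [Nat.mod_eq_sub_mod (by omega), Nat.mod_eq_of_lt (by omega)]
      omega
  have hBl : Finset.univ.filter (fun j => B j = ⟨m - 1, by omega⟩)
      = Finset.Ici (⟨m - 1, by omega⟩ : Fin (2 * m - 1)) := by
    ext j
    simp only [Finset.mem_filter, Finset.mem_univ, true_and, Finset.mem_Ici, Fin.ext_iff, hB,
      Fin.le_def]
    split_ifs <;> omega
  have hsum : (∑ j ∈ Finset.univ.filter (fun j => RR j = ⟨m - 1, by omega⟩), p j) = 1 / m := by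
    rw [hR, Finset.sum_singleton, hp]
    simp
  have hBsum : (∑ j ∈ Finset.univ.filter (fun j => B j = ⟨m - 1, by omega⟩), p j) = 1 := by
    rw [hBl, Finset.sum_congr rfl (g := fun _ => (1 : ℝ) / m), Finset.sum_const, Fin.card_Ici]
    · have : 2 * m - 1 - (m - 1) = m := by omega
      simp only [this, nsmul_eq_mul]
      field_simp
    · intro j hj
      rw [Finset.mem_Ici, Fin.le_def] at hj
      rw [hp, if_neg (by simpa using hj)]
  refine ⟨by rw [hR, Finset.card_singleton], hsum, ⟨⟨⟨m - 1, by omega⟩, ?_⟩, ?_⟩,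
    ⟨⟨⟨m - 1, by omega⟩, ?_⟩, ?_⟩⟩
  · simp only [mcLoad, hs, div_one]
    exact hsum
  · rintro _ ⟨i, rfl⟩
    simp only [mcLoad, hs, div_one (∑ j ∈ _, p j)]
    have hi := i.isLt
    refine le_trans (hp1 ⟨i, by omega⟩)
      (Finset.single_le_sum (f := p) (fun j _ => hp0 j) ?_)
    simp [Fin.ext_iff, hRR, Nat.mod_eq_of_lt hi]
  · simp only [mcLoad, hs, div_one]
    exact hBsum
  · rintro _ ⟨i, rfl⟩
    simp only [mcLoad, hs, div_one]
    have hi := i.isLt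
    by_cases h : (i : ℕ) < m - 1
    · have h1 : p ⟨i, by omega⟩ = 1 := by rw [hp, if_pos h]
      refine le_trans h1.ge
        (Finset.single_le_sum (f := p) (fun j _ => hp0 j) ?_)
      simp [Fin.ext_iff, hB, h]
    · have : i = ⟨m - 1, by omega⟩ := Fin.ext (by simp; omega)
      rw [this]
      exact hBsum.ge
end

section
/- Let i* ∈ {1, …, n−1} be an index maximizing min{σ1(i), σ2(i)}, and let W = max{σ1(i*), σ2(i*)} and w = min{σ1(i*), σ2(i*)} (SNC assigns the set of total size W to the faster machine M1 and the set of total size w to M2, so its cover equals min{W/s, w}). Then min{W/s, w} ≥ OPT / max{3/(s+1), 2s/(s+1)}. -/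
/-- `sigma1 n p i` = total size of the `i` largest jobs (jobs `1,…,i`,
1-indexed; jobs are 0-indexed in `p`). -/
noncomputable def sigma1 (n : ℕ) (p : Fin n → ℝ) (i : ℕ) : ℝ :=
  ∑ j ∈ Finset.univ.filter (fun j : Fin n => (j : ℕ) < i), p j

/-- `sigma2 n p i` = total size of the remaining jobs `i+1,…,n` (1-indexed). -/
noncomputable def sigma2 (n : ℕ) (p : Fin n → ℝ) (i : ℕ) : ℝ :=
  ∑ j ∈ Finset.univ.filter (fun j : Fin n => i ≤ (j : ℕ)), p j

/-- The cover of an assignment of the jobs to two machines, `M1` (machine `0`)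
of speed `s` and `M2` (machine `1`) of speed `1`. -/
noncomputable def twoCover (n : ℕ) (p : Fin n → ℝ) (s : ℝ)
    (A : Fin n → Fin 2) : ℝ :=
  min ((∑ j ∈ Finset.univ.filter (fun j => A j = 0), p j) / s)
      (∑ j ∈ Finset.univ.filter (fun j => A j = 1), p j)

theorem sig_add (n : ℕ) (p : Fin n → ℝ) (hsum : ∑ j, p j = 1) (i : ℕ) :
    sigma1 n p i + sigma2 n p i = 1 := by
  unfold sigma1 sigma2
  rw [← hsum, ← Finset.sum_filter_add_sum_filter_not Finset.univ (fun j : Fin n => (j : ℕ) < i)]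
  simp only [not_lt]

theorem sig_succ (n : ℕ) (p : Fin n → ℝ) (i : ℕ) (hi : i < n) :
    sigma1 n p (i + 1) = sigma1 n p i + p ⟨i, hi⟩ := by
  unfold sigma1
  have : Finset.univ.filter (fun j : Fin n => (j : ℕ) < i + 1)
      = insert ⟨i, hi⟩ (Finset.univ.filter (fun j : Fin n => (j : ℕ) < i)) := by
    ext j
    simp [Fin.ext_iff]
    omega
  rw [this, Finset.sum_insert (by simp)]
  ring

theorem sig_zero (n : ℕ) (p : Fin n → ℝ) : sigma1 n p 0 = 0 := by
  simp [sigma1]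

theorem sig_top (n : ℕ) (p : Fin n → ℝ) (hsum : ∑ j, p j = 1) : sigma1 n p n = 1 := by
  simp [sigma1, hsum]

theorem exists_third (n : ℕ) (hn : 2 ≤ n) (p : Fin n → ℝ)
    (hsort : ∀ i j : Fin n, i ≤ j → p j ≤ p i)
    (hsum : ∑ j, p j = 1) (h : p ⟨0, by omega⟩ ≤ 2 / 3) :
    ∃ i, 1 ≤ i ∧ i ≤ n - 1 ∧ 1 / 3 ≤ min (sigma1 n p i) (sigma2 n p i) := by
  classical
  have hex : ∃ i, 1 / 3 ≤ sigma1 n p i := ⟨n, by rw [sig_top n p hsum]; norm_num⟩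
  obtain ⟨i, hi, hlt⟩ : ∃ i, 1 / 3 ≤ sigma1 n p i ∧ ∀ m < i, sigma1 n p m < 1 / 3 :=
    ⟨Nat.find hex, Nat.find_spec hex, fun m hm => not_le.mp (Nat.find_min hex hm)⟩
  have hin : i ≤ n := by
    by_contra hc
    have := hlt n (by omega)
    rw [sig_top n p hsum] at this
    norm_num at this
  obtain _ | k := i
  · rw [sig_zero] at hi
    norm_num at hi
  have hk := hlt k (by omega)
  have hs := sig_succ n p k (by omega)
  have hle : sigma1 n p (k + 1) ≤ 2 / 3 := by
    obtain _ | m := k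
    · rw [hs, sig_zero]; linarith
    · have h0 := hlt 1 (by omega)
      have h1 := sig_succ n p 0 (by omega)
      rw [sig_zero] at h1
      have := hsort ⟨0, by omega⟩ ⟨m + 1, by omega⟩ (by simp [Fin.le_def])
      norm_num at h1
      linarith
  refine ⟨k + 1, by omega, ?_, ?_⟩
  · by_contra hc
    have : k + 1 = n := by omega
    rw [this, sig_top n p hsum] at hle
    norm_num at hle
  · have := sig_add n p hsum (k + 1)
    exact le_min hi (by linarith)

/-- if `i*` maximizes `min{σ1(i), σ2(i)}` over `i ∈ {1,…,n−1}`,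
and SNC assigns the part of size `W = max{σ1(i*),σ2(i*)}` to the faster
machine and the part of size `w = min{σ1(i*),σ2(i*)}` to the slower one, then
its cover `min{W/s, w}` is at least `OPT / max{3/(s+1), 2s/(s+1)}`. -/
theorem stmt9 (n : ℕ) (hn : 2 ≤ n) (p : Fin n → ℝ)
    (hp : ∀ j, 0 < p j) (hsort : ∀ i j : Fin n, i ≤ j → p j ≤ p i)
    (hsum : ∑ j, p j = 1)
    (s : ℝ) (hs : 1 ≤ s)
    (OPT : ℝ)
    (hOPT : IsGreatest (Set.range fun A : Fin n → Fin 2 => twoCover n p s A) OPT)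
    (istar : ℕ) (h1 : 1 ≤ istar) (h2 : istar ≤ n - 1)
    (hmax : ∀ i, 1 ≤ i → i ≤ n - 1 →
      min (sigma1 n p i) (sigma2 n p i)
        ≤ min (sigma1 n p istar) (sigma2 n p istar)) :
    OPT / max (3 / (s + 1)) (2 * s / (s + 1))
      ≤ min (max (sigma1 n p istar) (sigma2 n p istar) / s)
            (min (sigma1 n p istar) (sigma2 n p istar)) := by
  obtain ⟨⟨A, hA⟩, -⟩ := hOPT
  have hs0 : 0 < s := by linarith
  have hs1 : 0 < s + 1 := by linarith
  simp only [twoCover] at hA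
  set a := ∑ j ∈ Finset.univ.filter (fun j => A j = 0), p j with ha
  set b := ∑ j ∈ Finset.univ.filter (fun j => A j = 1), p j with hb
  have hab : a + b = 1 := by
    rw [← hsum, ha, hb, ← Finset.sum_filter_add_sum_filter_not Finset.univ (fun j => A j = 0)]
    congr 2
    ext j
    simp only [Finset.mem_filter, Finset.mem_univ, true_and]
    omega
  have ha0 : 0 ≤ a := Finset.sum_nonneg fun j _ => (hp j).le
  have hb0 : 0 ≤ b := Finset.sum_nonneg fun j _ => (hp j).le
  have hOa : OPT * s ≤ a := by
    rw [← le_div_iff₀ hs0, ← hA]; exact min_le_left _ _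
  have hOb : OPT ≤ b := by rw [← hA]; exact min_le_right _ _
  have hO0 : 0 ≤ OPT := by rw [← hA]; exact le_min (by positivity) hb0
  have hO : OPT ≤ 1 / (s + 1) := by
    rw [le_div_iff₀ hs1]; linarith
  have hsa := sig_add n p hsum istar
  set R := max (3 / (s + 1)) (2 * s / (s + 1)) with hR
  have hR1 : 3 / (s + 1) ≤ R := le_max_left _ _
  have hR2 : 2 * s / (s + 1) ≤ R := le_max_right _ _
  have hR3 : 1 ≤ R := le_trans (by rw [le_div_iff₀ hs1]; linarith) hR2
  have hR0 : 0 < R := by linarith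
  rw [div_le_iff₀ hR0]
  set W := max (sigma1 n p istar) (sigma2 n p istar) with hW
  set w := min (sigma1 n p istar) (sigma2 n p istar) with hw
  have hW2 : 1 / 2 ≤ W := by
    have h3 : sigma1 n p istar ≤ W := le_max_left _ _
    have h4 : sigma2 n p istar ≤ W := le_max_right _ _
    linarith
  have key1 : OPT ≤ W / s * R := by
    calc OPT ≤ 1 / (s + 1) := hO
      _ = (1 / 2) / s * (2 * s / (s + 1)) := by field_simp
      _ ≤ W / s * R := by gcongr
  have key2 : OPT ≤ w * R := by
    by_cases h : p ⟨0, by omega⟩ ≤ 2 / 3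
    · obtain ⟨i, hi1, hi2, hi3⟩ := exists_third n hn p hsort hsum h
      have hw3 : 1 / 3 ≤ w := hi3.trans (hmax i hi1 hi2)
      calc OPT ≤ 1 / (s + 1) := hO
        _ = 1 / 3 * (3 / (s + 1)) := by field_simp
        _ ≤ w * R := by gcongr
    · push Not at h
      have e1 := sig_succ n p 0 (by omega)
      rw [sig_zero, zero_add, zero_add] at e1
      have e2 := sig_add n p hsum 1
      have hw1 := hmax 1 le_rfl (by omega)
      have hOw : OPT ≤ 1 - p ⟨0, by omega⟩ := by
        by_cases hA0 : A ⟨0, by omega⟩ = 0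
        · have : p ⟨0, by omega⟩ ≤ a := Finset.single_le_sum (f := p)
            (fun j _ => (hp j).le) (by simp [hA0])
          linarith
        · have : p ⟨0, by omega⟩ ≤ b := Finset.single_le_sum (f := p)
            (fun j _ => (hp j).le) (by simp; omega)
          nlinarith
      have hww : OPT ≤ w := by
        refine le_trans (le_min ?_ ?_) hw1 <;> linarith
      nlinarith
  rcases min_choice (W / s) w with h | h <;> rw [h] <;> assumption
end

section
/- Let r ≥ 1 and let i ∈ {1, …, n−1} be an index maximizing min{σ1(i)/r, σ2(i)}. Then σ1(i)/r ≥ σ2(i) − p_{i+1} and σ1(i) − p_i ≤ r·σ2(i). -/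
theorem sigma1_succ_aux (n : ℕ) (p : Fin n → ℝ) (i : ℕ) (h : i < n) :
    sigma1 n p (i + 1) = sigma1 n p i + p ⟨i, h⟩ := by
  unfold sigma1
  have : (Finset.univ.filter (fun j : Fin n => (j : ℕ) < i + 1))
      = insert ⟨i, h⟩ (Finset.univ.filter (fun j : Fin n => (j : ℕ) < i)) := by
    ext j
    simp only [Finset.mem_filter, Finset.mem_univ, true_and, Finset.mem_insert, Fin.ext_iff]
    omega
  rw [this, Finset.sum_insert (by simp), add_comm]

theorem sigma2_succ_aux (n : ℕ) (p : Fin n → ℝ) (i : ℕ) (h : i < n) :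
    sigma2 n p i = sigma2 n p (i + 1) + p ⟨i, h⟩ := by
  unfold sigma2
  have : (Finset.univ.filter (fun j : Fin n => i ≤ (j : ℕ)))
      = insert ⟨i, h⟩ (Finset.univ.filter (fun j : Fin n => i + 1 ≤ (j : ℕ))) := by
    ext j
    simp only [Finset.mem_filter, Finset.mem_univ, true_and, Finset.mem_insert, Fin.ext_iff]
    omega
  rw [this, Finset.sum_insert (by simp), add_comm]

/-- if `r ≥ 1` and `i ∈ {1,…,n−1}` maximizes
`min{σ1(i)/r, σ2(i)}`, then `σ1(i)/r ≥ σ2(i) − p_{i+1}` and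
`σ1(i) − p_i ≤ r·σ2(i)`.  (Here `p_i = p ⟨i-1,_⟩` and `p_{i+1} = p ⟨i,_⟩`
since `p` is 0-indexed.) -/
theorem stmt11 (n : ℕ) (hn : 2 ≤ n) (p : Fin n → ℝ)
    (hp : ∀ j, 0 < p j) (hsort : ∀ i j : Fin n, i ≤ j → p j ≤ p i)
    (hsum : ∑ j, p j = 1)
    (r : ℝ) (hr : 1 ≤ r)
    (i : ℕ) (h1 : 1 ≤ i) (h2 : i ≤ n - 1)
    (hmax : ∀ i', 1 ≤ i' → i' ≤ n - 1 →
      min (sigma1 n p i' / r) (sigma2 n p i')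
        ≤ min (sigma1 n p i / r) (sigma2 n p i)) :
    sigma2 n p i - p ⟨i, by omega⟩ ≤ sigma1 n p i / r ∧
    sigma1 n p i - p ⟨i - 1, by omega⟩ ≤ r * sigma2 n p i := by
  have hr0 : 0 < r := by linarith
  have hin : i < n := by omega
  have n1 : ∀ k, 0 ≤ sigma1 n p k := fun k => Finset.sum_nonneg fun j _ => (hp j).le
  have n2 : ∀ k, 0 ≤ sigma2 n p k := fun k => Finset.sum_nonneg fun j _ => (hp j).le
  constructor
  · have e2 := sigma2_succ_aux n p i hin
    have e1 := sigma1_succ_aux n p i hin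
    have hpi := hp ⟨i, hin⟩
    by_contra! hc
    have hc' : sigma1 n p i / r < sigma2 n p (i + 1) := by linarith
    by_cases hi : i + 1 ≤ n - 1
    · have hm := (hmax (i + 1) (by omega) hi).trans (min_le_left _ _)
      have : sigma1 n p i / r < sigma1 n p (i + 1) / r :=
        div_lt_div_of_pos_right (by linarith) hr0
      exact absurd (lt_min this hc') (not_lt.mpr hm)
    · have hz : sigma2 n p (i + 1) = 0 := by
        unfold sigma2
        apply Finset.sum_eq_zero
        intro j hj
        have := (Finset.mem_filter.mp hj).2
        have := j.2
        omega
      have := div_nonneg (n1 i) hr0.le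
      linarith
  · obtain ⟨k, rfl⟩ : ∃ k, i = k + 1 := ⟨i - 1, by omega⟩
    have hkn : k < n := by omega
    have e2 := sigma2_succ_aux n p k hkn
    have e1 := sigma1_succ_aux n p k hkn
    have hpk := hp ⟨k, hkn⟩
    by_contra! hc
    simp only [Nat.add_sub_cancel] at hc
    have hc' : r * sigma2 n p (k + 1) < sigma1 n p k := by linarith
    by_cases hk : 1 ≤ k
    · have hm := (hmax k hk (by omega)).trans (min_le_right _ _)
      have : sigma2 n p (k + 1) < sigma1 n p k / r := by
        rw [lt_div_iff₀ hr0]; linarith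
      exact absurd (lt_min this (by linarith)) (not_lt.mpr hm)
    · have hz : sigma1 n p k = 0 := by
        unfold sigma1
        apply Finset.sum_eq_zero
        intro j hj
        have := (Finset.mem_filter.mp hj).2
        omega
      have := mul_nonneg hr0.le (n2 (k + 1))
      linarith
end

section
/- Let r_s > r_q ≥ 1, let i_s ∈ {1, …, n−1} be any index maximizing min{σ1(i)/r_s, σ2(i)}, and let i_q ∈ {1, …, n−1} be any index maximizing min{σ1(i)/r_q, σ2(i)}. Then max{σ1(i_s), σ2(i_s)} ≥ max{σ1(i_q), σ2(i_q)} and min{σ1(i_s), σ2(i_s)} ≤ min{σ1(i_q), σ2(i_q)}; that is, as the speed ratio increases, the larger part of the chosen partition does not decrease and the smaller part does not increase. -/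
/-- let `r_s > r_q ≥ 1`, let `i_s` maximize
`min{σ1(i)/r_s, σ2(i)}` over `i ∈ {1,…,n−1}` and `i_q` maximize
`min{σ1(i)/r_q, σ2(i)}`. Then `max{σ1(i_s),σ2(i_s)} ≥ max{σ1(i_q),σ2(i_q)}`
and `min{σ1(i_s),σ2(i_s)} ≤ min{σ1(i_q),σ2(i_q)}`. -/
theorem stmt12 (n : ℕ) (hn : 2 ≤ n) (p : Fin n → ℝ)
    (hp : ∀ j, 0 < p j) (hsort : ∀ i j : Fin n, i ≤ j → p j ≤ p i)
    (hsum : ∑ j, p j = 1)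
    (rs rq : ℝ) (hq : 1 ≤ rq) (hsq : rq < rs)
    (is_ : ℕ) (his1 : 1 ≤ is_) (his2 : is_ ≤ n - 1)
    (hmaxs : ∀ i, 1 ≤ i → i ≤ n - 1 →
      min (sigma1 n p i / rs) (sigma2 n p i)
        ≤ min (sigma1 n p is_ / rs) (sigma2 n p is_))
    (iq : ℕ) (hiq1 : 1 ≤ iq) (hiq2 : iq ≤ n - 1)
    (hmaxq : ∀ i, 1 ≤ i → i ≤ n - 1 →
      min (sigma1 n p i / rq) (sigma2 n p i)
        ≤ min (sigma1 n p iq / rq) (sigma2 n p iq)) :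
    max (sigma1 n p iq) (sigma2 n p iq)
      ≤ max (sigma1 n p is_) (sigma2 n p is_) ∧
    min (sigma1 n p is_) (sigma2 n p is_)
      ≤ min (sigma1 n p iq) (sigma2 n p iq) := by
  have hs2 : ∀ i, sigma2 n p i = 1 - sigma1 n p i := by
    intro i
    have h := Finset.sum_filter_add_sum_filter_not Finset.univ (fun j : Fin n => (j : ℕ) < i) p
    simp only [not_lt] at h
    unfold sigma1 sigma2
    linarith
  have hpa : 0 ≤ sigma1 n p iq := Finset.sum_nonneg (fun j _ => (hp j).le)
  have hpos : 0 < sigma1 n p is_ := by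
    unfold sigma1
    apply Finset.sum_pos (fun j _ => hp j)
    exact ⟨⟨0, by omega⟩, by simp; omega⟩
  have h1 := hmaxs iq hiq1 hiq2
  have h2 := hmaxq is_ his1 his2
  rw [hs2, hs2] at h1 h2 ⊢
  generalize sigma1 n p is_ = b at *
  generalize sigma1 n p iq = a at *
  have hrq : 0 < rq := by linarith
  have hrs : 0 < rs := by linarith
  have hab : a ≤ b := by
    by_contra hlt
    push Not at hlt
    have e1 : b / rs < a / rs := div_lt_div_of_pos_right hlt hrs
    have e2 : b / rs < b / rq := div_lt_div_of_pos_left hpos hrq hsq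
    have e3 : 1 - a ≤ b / rs := by
      rcases min_le_iff.1 (h1.trans (min_le_left _ _)) with h | h <;> linarith
    have e4 := h2.trans (min_le_right _ _)
    rcases min_le_iff.1 e4 with h | h <;> linarith
  rcases hab.eq_or_lt with h | hlt
  · subst h
    exact ⟨le_rfl, le_rfl⟩
  have hb : 1 - a ≤ b := by
    by_cases ha : 1 / 2 ≤ a
    · linarith
    have e1 : a / rq < b / rq := div_lt_div_of_pos_right hlt hrq
    have e2 : 1 - b ≤ a / rq := by
      rcases min_le_iff.1 (h2.trans (min_le_left _ _)) with h | h <;> linarith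
    rw [le_div_iff₀ hrq] at e2
    by_contra hc
    push Not at hc
    nlinarith
  refine ⟨max_le (le_max_of_le_left hab) (le_max_of_le_left hb),
    le_min (min_le_of_right_le ?_) (min_le_of_right_le ?_)⟩ <;> linarith
end

section
/- Assume OPT > 0 and fix an assignment achieving the optimal cover; let μ be the total size of the jobs it places on M1 (so OPT = min{μ/s, 1 − μ}). Then there exists an index i' ∈ {1, …, n−1} such that s·OPT/(s+1) ≤ σ2(i') ≤ s·OPT/(s+1) + (1 − μ), and this i' satisfies σ1(i') ≥ s²·OPT/(s+1). -/
/-- assume `OPT > 0` and fix an optimal assignment `A`, placing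
total size `μ` on `M1` (so `OPT = min{μ/s, 1−μ}`). Then some index
`i' ∈ {1,…,n−1}` satisfies `s·OPT/(s+1) ≤ σ2(i') ≤ s·OPT/(s+1) + (1−μ)`, and
this `i'` also satisfies `σ1(i') ≥ s²·OPT/(s+1)`. -/
theorem stmt14 (n : ℕ) (hn : 2 ≤ n) (p : Fin n → ℝ)
    (hp : ∀ j, 0 < p j) (hsort : ∀ i j : Fin n, i ≤ j → p j ≤ p i)
    (hsum : ∑ j, p j = 1)
    (s : ℝ) (hs : 1 ≤ s)
    (OPT : ℝ) (hOPTpos : 0 < OPT)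
    (hOPT : IsGreatest (Set.range fun A : Fin n → Fin 2 => twoCover n p s A) OPT)
    (A : Fin n → Fin 2) (μ : ℝ)
    (hμ : ∑ j ∈ Finset.univ.filter (fun j => A j = 0), p j = μ)
    (hach : twoCover n p s A = OPT)
    (hform : OPT = min (μ / s) (1 - μ)) :
    ∃ i', 1 ≤ i' ∧ i' ≤ n - 1 ∧
      s * OPT / (s + 1) ≤ sigma2 n p i' ∧
      sigma2 n p i' ≤ s * OPT / (s + 1) + (1 - μ) ∧
      s ^ 2 * OPT / (s + 1) ≤ sigma1 n p i' := by
  have hs1 : (0:ℝ) < s + 1 := by linarith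
  have hs0 : (0:ℝ) < s := by linarith
  set c := s * OPT / (s + 1) with hc
  have hcmul : c * (s + 1) = s * OPT := by rw [hc]; field_simp
  have hcpos : 0 < c := by positivity
  have hcO : c < OPT := by nlinarith
  have h1 : s * OPT ≤ μ := by
    have : OPT ≤ μ / s := hform ▸ min_le_left _ _
    rw [le_div_iff₀ hs0] at this
    linarith
  have h2 : OPT ≤ 1 - μ := by
    rw [hform]
    exact min_le_right _ _
  have hfilt : Finset.univ.filter (fun j => ¬ A j = 0) =
      Finset.univ.filter (fun j => A j = 1) := by
    ext j
    simp only [Finset.mem_filter, Finset.mem_univ, true_and]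
    omega
  have hM2 : ∑ j ∈ Finset.univ.filter (fun j => A j = 1), p j = 1 - μ := by
    have := Finset.sum_filter_add_sum_filter_not Finset.univ (fun j => A j = 0) p
    rw [hfilt, hsum, hμ] at this
    linarith
  have hsplit : ∀ i, sigma1 n p i + sigma2 n p i = 1 := by
    intro i
    have := Finset.sum_filter_add_sum_filter_not Finset.univ (fun j : Fin n => (j : ℕ) < i) p
    simp only [not_lt] at this
    rw [hsum] at this
    exact this
  have hz : sigma2 n p n = 0 := by
    unfold sigma2
    apply Finset.sum_eq_zero
    intro j hj
    have := (Finset.mem_filter.mp hj).2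
    have := j.isLt
    omega
  have h10 : sigma1 n p 0 = 0 := by simp [sigma1]
  have hex : ∃ k, sigma2 n p k < c := ⟨n, by rw [hz]; exact hcpos⟩
  classical
  obtain ⟨k, hk, hkmin⟩ : ∃ k, sigma2 n p k < c ∧ ∀ m < k, ¬ sigma2 n p m < c :=
    ⟨Nat.find hex, Nat.find_spec hex, fun m hm => Nat.find_min hex hm⟩
  have hkn : k ≤ n := by
    by_contra h
    exact hkmin n (by omega) (by rw [hz]; exact hcpos)
  have hk0 : k ≠ 0 := by
    rintro rfl
    have := hsplit 0
    nlinarith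
  obtain ⟨m, rfl⟩ := Nat.exists_eq_succ_of_ne_zero hk0
  have hm : c ≤ sigma2 n p m := not_lt.mp (hkmin m (by omega))
  have hstep : sigma2 n p m = p ⟨m, by omega⟩ + sigma2 n p (m + 1) := by
    unfold sigma2
    rw [← Finset.sum_insert (a := (⟨m, by omega⟩ : Fin n)) (by simp)]
    congr 1
    ext j
    simp only [Finset.mem_filter, Finset.mem_univ, true_and, Finset.mem_insert, Fin.ext_iff]
    omega
  have hpm : p ⟨m, by omega⟩ ≤ 1 - μ := by
    by_contra hcon
    push Not at hcon
    have hle : 1 - μ ≤ sigma2 n p (m + 1) := by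
      rw [← hM2]
      unfold sigma2
      apply Finset.sum_le_sum_of_subset_of_nonneg
      · intro j hj
        have hj1 : p j ≤ 1 - μ := by
          rw [← hM2]
          exact Finset.single_le_sum (f := p) (fun i _ => (hp i).le) hj
        simp only [Finset.mem_filter, Finset.mem_univ, true_and]
        by_contra hlt
        have := hsort j ⟨m, by omega⟩ (by rw [Fin.le_def]; simp; omega)
        linarith
      · intro i _ _
        exact (hp i).le
    have : sigma2 n p (m + 1) < c := hk
    linarith
  have hk' : sigma2 n p (m + 1) < c := hk
  have hub : sigma2 n p m ≤ c + (1 - μ) := by linarith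
  have h3 : s ^ 2 * OPT / (s + 1) = s * c := by rw [hc]; ring
  have hlow : s * c ≤ sigma1 n p m := by
    have := hsplit m
    nlinarith
  refine ⟨m, ?_, by omega, hm, hub, by rw [h3]; exact hlow⟩
  by_contra h0
  have : m = 0 := by omega
  subst this
  rw [h10] at hlow
  nlinarith
end

section
/- Let s > (1+√5)/2 and let 0 < ε < (s² − s − 1)/(2(s+1)²). Consider the three jobs p_1 = s²/(s+1)² − ε, p_2 = 1/(s+1) + ε, p_3 = s/(s+1)². Then p_1 ≥ p_2 ≥ p_3 > 0 and they sum to 1; the index i = 2 is the unique maximizer of min{σ1(i)/s, σ2(i)} over i ∈ {1, 2}, and SSNC's cover min{σ1(2)/s, σ2(2)} equals s/(s+1)²; meanwhile the assignment placing jobs 1 and 3 on M1 and job 2 on M2 achieves a cover of 1/(s+1) − ε/s. Hence the approximation ratio of SSNC is not better than 1 + 1/s. -/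
/-- lower-bound instance for SSNC on two machines (speeds `s,1`)
with `s > (1+√5)/2` and `0 < ε < (s²−s−1)/(2(s+1)²)`: the three jobs
`p₁ = s²/(s+1)² − ε`, `p₂ = 1/(s+1) + ε`, `p₃ = s/(s+1)²` are sorted, positive
and sum to `1`; `i = 2` is the unique maximizer of `min{σ1(i)/s, σ2(i)}` over
`i ∈ {1,2}`, and SSNC's cover is `min{σ1(2)/s, σ2(2)} = s/(s+1)²`, while the
assignment placing jobs `1` and `3` on `M1` and job `2` on `M2` has cover
`1/(s+1) − ε/s`. Hence SSNC's approximation ratio is not better than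
`1 + 1/s`. -/
theorem stmt15 (s ε : ℝ) (hs : (1 + Real.sqrt 5) / 2 < s)
    (hε0 : 0 < ε) (hε1 : ε < (s ^ 2 - s - 1) / (2 * (s + 1) ^ 2))
    (p : Fin 3 → ℝ)
    (hp0 : p 0 = s ^ 2 / (s + 1) ^ 2 - ε)
    (hp1 : p 1 = 1 / (s + 1) + ε)
    (hp2 : p 2 = s / (s + 1) ^ 2) :
    (p 1 ≤ p 0 ∧ p 2 ≤ p 1 ∧ 0 < p 2 ∧ p 0 + p 1 + p 2 = 1) ∧
    (∀ i, 1 ≤ i → i ≤ 2 → i ≠ 2 →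
      min (sigma1 3 p i / s) (sigma2 3 p i)
        < min (sigma1 3 p 2 / s) (sigma2 3 p 2)) ∧
    min (sigma1 3 p 2 / s) (sigma2 3 p 2) = s / (s + 1) ^ 2 ∧
    min ((p 0 + p 2) / s) (p 1) = 1 / (s + 1) - ε / s := by
  have hs0 : 0 < s := by
    have := Real.sqrt_nonneg 5
    linarith
  have hs1 : 0 < s + 1 := by linarith
  have hq : 0 < (s + 1) ^ 2 := by positivity
  have e1 : 1 / (s + 1) = s / (s + 1) ^ 2 + 1 / (s + 1) ^ 2 := by
    field_simp
  have e2 : s ^ 2 / (s + 1) ^ 2 = 1 - 2 * (s / (s + 1) ^ 2) - 1 / (s + 1) ^ 2 := by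
    field_simp
    ring
  have e3 : (s ^ 2 - s - 1) / (2 * (s + 1) ^ 2)
      = (s ^ 2 / (s + 1) ^ 2 - s / (s + 1) ^ 2 - 1 / (s + 1) ^ 2) / 2 := by
    field_simp
  have hb : 0 < 1 / (s + 1) ^ 2 := by positivity
  have ha : 0 < s / (s + 1) ^ 2 := by positivity
  have hes : 0 < ε / s := by positivity
  have h11 : sigma1 3 p 1 = p 0 := by
    simp [sigma1, Finset.sum_filter, Fin.sum_univ_three]
  have h12 : sigma1 3 p 2 = p 0 + p 1 := by
    simp [sigma1, Finset.sum_filter, Fin.sum_univ_three]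
  have h22 : sigma2 3 p 2 = p 2 := by
    simp [sigma2, Finset.sum_filter, Fin.sum_univ_three]
  have hm : min (sigma1 3 p 2 / s) (sigma2 3 p 2) = s / (s + 1) ^ 2 := by
    rw [h12, h22, hp2]
    apply min_eq_right
    rw [hp0, hp1, le_div_iff₀ hs0]
    have : s / (s + 1) ^ 2 * s = s ^ 2 / (s + 1) ^ 2 := by ring
    rw [this]
    linarith
  refine ⟨⟨?_, ?_, ?_, ?_⟩, ?_, hm, ?_⟩
  · rw [hp0, hp1]
    linarith
  · rw [hp1, hp2]
    linarith
  · rw [hp2]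
    exact ha
  · rw [hp0, hp1, hp2]
    linarith
  · intro i hi1 hi2 hi
    have hi' : i = 1 := by omega
    subst hi'
    rw [hm]
    apply lt_of_le_of_lt (min_le_left _ _)
    rw [h11, hp0]
    have : (s ^ 2 / (s + 1) ^ 2 - ε) / s = s / (s + 1) ^ 2 - ε / s := by
      field_simp
    rw [this]
    linarith
  · have : (p 0 + p 2) / s = 1 / (s + 1) - ε / s := by
      rw [hp0, hp2]
      field_simp
      ring
    rw [this, hp1]
    apply min_eq_left
    linarith
end

section
/- Let 1 ≤ s ≤ 3/2 and consider the four jobs p_1 = 1/3, p_2 = 1/3, p_3 = (2s−1)/(3s+3), p_4 = (2−s)/(3s+3). Then p_1 ≥ p_2 ≥ p_3 ≥ p_4 > 0 and they sum to 1; the maximum over i ∈ {1, 2, 3} of min{σ1(i), σ2(i)} equals 1/3, and for every maximizing index i, SNC's cover min{max(σ1(i),σ2(i))/s, min(σ1(i),σ2(i))} equals 1/3; meanwhile the assignment placing jobs 1 and 3 on M1 and jobs 2 and 4 on M2 achieves a cover of 1/(s+1). Hence the approximation ratio of SNC is not better than 3/(s+1). -/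
/-- lower-bound instance for SNC on two machines (speeds `s,1`)
with `1 ≤ s ≤ 3/2`: the four jobs `p₁ = p₂ = 1/3`, `p₃ = (2s−1)/(3s+3)`,
`p₄ = (2−s)/(3s+3)` are sorted, positive and sum to `1`; the maximum over
`i ∈ {1,2,3}` of `min{σ1(i),σ2(i)}` equals `1/3`, and for every maximizing
index SNC's cover equals `1/3`, while the assignment placing jobs `1,3` on
`M1` and jobs `2,4` on `M2` has cover `1/(s+1)`. Hence SNC's approximation
ratio is not better than `3/(s+1)`. -/
theorem stmt17 (s : ℝ) (hs1 : 1 ≤ s) (hs2 : s ≤ 3 / 2)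
    (p : Fin 4 → ℝ)
    (hp0 : p 0 = 1 / 3)
    (hp1 : p 1 = 1 / 3)
    (hp2 : p 2 = (2 * s - 1) / (3 * s + 3))
    (hp3 : p 3 = (2 - s) / (3 * s + 3)) :
    (p 1 ≤ p 0 ∧ p 2 ≤ p 1 ∧ p 3 ≤ p 2 ∧ 0 < p 3 ∧
      p 0 + p 1 + p 2 + p 3 = 1) ∧
    (∀ i, 1 ≤ i → i ≤ 3 → min (sigma1 4 p i) (sigma2 4 p i) ≤ 1 / 3) ∧
    (∃ i, 1 ≤ i ∧ i ≤ 3 ∧ min (sigma1 4 p i) (sigma2 4 p i) = 1 / 3) ∧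
    (∀ i, 1 ≤ i → i ≤ 3 → min (sigma1 4 p i) (sigma2 4 p i) = 1 / 3 →
      min (max (sigma1 4 p i) (sigma2 4 p i) / s)
          (min (sigma1 4 p i) (sigma2 4 p i)) = 1 / 3) ∧
    min ((p 0 + p 2) / s) (p 1 + p 3) = 1 / (s + 1) := by
  have hpos : (0:ℝ) < 3 * s + 3 := by linarith
  have hs0 : (0:ℝ) < s := by linarith
  have h23 : p 2 + p 3 = 1 / 3 := by
    rw [hp2, hp3]; field_simp; ring
  have h3pos : 0 < p 3 := by
    rw [hp3]; apply div_pos <;> linarith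
  have h32 : p 3 ≤ p 2 := by
    rw [hp2, hp3]; gcongr; linarith
  have a1 : sigma1 4 p 1 = 1 / 3 := by
    simp [sigma1, Finset.sum_filter, Fin.sum_univ_four, hp0]
  have a2 : sigma1 4 p 2 = 2 / 3 := by
    simp [sigma1, Finset.sum_filter, Fin.sum_univ_four, hp0, hp1]; norm_num
  have a3 : sigma1 4 p 3 = 2 / 3 + p 2 := by
    simp [sigma1, Finset.sum_filter, Fin.sum_univ_four, hp0, hp1]; norm_num
  have b1 : sigma2 4 p 1 = 2 / 3 := by
    simp [sigma2, Finset.sum_filter, Fin.sum_univ_four]; linarith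
  have b2 : sigma2 4 p 2 = 1 / 3 := by
    simp [sigma2, Finset.sum_filter, Fin.sum_univ_four]; linarith
  have b3 : sigma2 4 p 3 = p 3 := by
    simp [sigma2, Finset.sum_filter, Fin.sum_univ_four]
  have m1 : min (1 / 3 : ℝ) (2 / 3) = 1 / 3 := min_eq_left (by norm_num)
  have m2 : min (2 / 3 : ℝ) (1 / 3) = 1 / 3 := min_eq_right (by norm_num)
  have m3 : min (2 / 3 + p 2) (p 3) = p 3 := min_eq_right (by linarith)
  have x1 : max (1 / 3 : ℝ) (2 / 3) = 2 / 3 := max_eq_right (by norm_num)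
  have x2 : max (2 / 3 : ℝ) (1 / 3) = 2 / 3 := max_eq_left (by norm_num)
  have hc : min (2 / 3 / s) (1 / 3) = 1 / 3 := by
    apply min_eq_right
    rw [le_div_iff₀ hs0]; linarith
  refine ⟨⟨by linarith, by linarith, h32, h3pos, by linarith⟩, ?_, ?_, ?_, ?_⟩
  · intro i h1 h2
    interval_cases i
    · rw [a1, b1, m1]
    · rw [a2, b2, m2]
    · rw [a3, b3, m3]; linarith
  · exact ⟨1, le_refl _, by norm_num, by rw [a1, b1, m1]⟩
  · intro i h1 h2 h
    interval_cases i
    · rw [a1, b1, m1, x1, hc]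
    · rw [a2, b2, m2, x2, hc]
    · rw [a3, b3, m3] at h; linarith
  · have e1 : (p 0 + p 2) / s = 1 / (s + 1) := by
      rw [hp0, hp2]; field_simp; ring
    have e2 : p 1 + p 3 = 1 / (s + 1) := by
      rw [hp1, hp3]; field_simp; ring
    rw [e1, e2, min_self]
end
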